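/- The linear map σ : Λ → Λ determined by σ(v_S) = v_{−S} (where −S := {−x : x ∈ S}) is bijective, preserves each Λ^k, and satisfies σ∘e_i = f_i∘σ, σ∘f_i = e_i∘σ and σ∘k_i = k_i⁻¹∘σ for all i ∈ {1,…,n}. -/

import Mathlib

noncomputable section

/-- The field `𝔽 = ℚ(q)`. -/
abbrev Fq : Type := RatFunc ℚ

/-- The quantum parameter `q`. -/
def qv : Fq := RatFunc.X

/-- The index set `I = {1,…,n} ∪ {−n,…,−1}` as a finset of integers. -/
def Iset (n : ℕ) : Finset ℤ := (Finset.Icc (-(n : ℤ)) (n : ℤ)).erase 0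

/-- Subsets of `I`, the index type for the standard basis. -/
abbrev Bset (n : ℕ) : Type := {S : Finset ℤ // S ⊆ Iset n}

/-- `Λ`, the free `𝔽`-vector space with basis `{v_S : S ⊆ I}`. -/
abbrev Lam (n : ℕ) : Type := Bset n →₀ Fq

/-- The standard basis vector `v_S`. -/
def bv (n : ℕ) (S : Bset n) : Lam n := Finsupp.single S 1

/-- The standard basis vector `v_T` for a finset `T ⊆ I` (and `0` for junk input). -/
def vS (n : ℕ) (T : Finset ℤ) : Lam n :=
  if h : T ⊆ Iset n then Finsupp.single (⟨T, h⟩ : Bset n) (1 : Fq) else 0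

/-- The linear operator on `Λ` determined by prescribed values on the standard basis. -/
def mkOp (n : ℕ) (g : Bset n → Lam n) : Module.End Fq (Lam n) :=
  Finsupp.linearCombination Fq g

/-- The four positions `{i, i+1, −i, −(i+1)}`. -/
def quad (i : ℤ) : Finset ℤ := {i, i + 1, -i, -(i + 1)}

/-- Value of `f_i` on `v_S`. -/
def fAct (n : ℕ) (i : ℤ) (S : Finset ℤ) : Lam n :=
  if i = (n : ℤ) then
    (if (n : ℤ) ∈ S ∧ -(n : ℤ) ∉ S then vS n (insert (-(n : ℤ)) (S.erase (n : ℤ))) else 0)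
  else
    (if S ∩ quad i = {i} then vS n (insert (i + 1) (S.erase i))
     else if S ∩ quad i = {-(i + 1)} then vS n (insert (-i) (S.erase (-(i + 1))))
     else if S ∩ quad i = ({i, -(i + 1)} : Finset ℤ) then
       vS n (insert (-i) (S.erase (-(i + 1)))) + qv⁻¹ • vS n (insert (i + 1) (S.erase i))
     else if S ∩ quad i = ({i, -i} : Finset ℤ) then qv • vS n (insert (i + 1) (S.erase i))
     else if S ∩ quad i = ({i + 1, -(i + 1)} : Finset ℤ) then
       vS n (insert (-i) (S.erase (-(i + 1))))
     else if S ∩ quad i = ({i, -(i + 1), -i} : Finset ℤ) then vS n (insert (i + 1) (S.erase i))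
     else if S ∩ quad i = ({i, i + 1, -(i + 1)} : Finset ℤ) then
       vS n (insert (-i) (S.erase (-(i + 1))))
     else 0)

/-- Value of `e_i` on `v_S`. -/
def eAct (n : ℕ) (i : ℤ) (S : Finset ℤ) : Lam n :=
  if i = (n : ℤ) then
    (if -(n : ℤ) ∈ S ∧ (n : ℤ) ∉ S then vS n (insert (n : ℤ) (S.erase (-(n : ℤ)))) else 0)
  else
    (if S ∩ quad i = {-i} then vS n (insert (-(i + 1)) (S.erase (-i)))
     else if S ∩ quad i = {i + 1} then vS n (insert i (S.erase (i + 1)))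
     else if S ∩ quad i = ({i + 1, -i} : Finset ℤ) then
       vS n (insert i (S.erase (i + 1))) + qv⁻¹ • vS n (insert (-(i + 1)) (S.erase (-i)))
     else if S ∩ quad i = ({i, -i} : Finset ℤ) then qv • vS n (insert (-(i + 1)) (S.erase (-i)))
     else if S ∩ quad i = ({i + 1, -(i + 1)} : Finset ℤ) then vS n (insert i (S.erase (i + 1)))
     else if S ∩ quad i = ({i, i + 1, -i} : Finset ℤ) then
       vS n (insert (-(i + 1)) (S.erase (-i)))
     else if S ∩ quad i = ({i + 1, -(i + 1), -i} : Finset ℤ) then vS n (insert i (S.erase (i + 1)))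
     else 0)

/-- Coefficient of `ε_j` in `wt(S)`. -/
def epsCoef (S : Finset ℤ) (j : ℤ) : ℤ :=
  (if j ∈ S then 1 else 0) - (if -j ∈ S then 1 else 0)

/-- The pairing `(α_i, wt S)`. -/
def alphaPair (n : ℕ) (i : ℤ) (S : Finset ℤ) : ℤ :=
  if i = (n : ℤ) then 2 * epsCoef S (n : ℤ) else epsCoef S i - epsCoef S (i + 1)

/-- The operator `f_i` on `Λ`. -/
def fop (n : ℕ) (i : ℤ) : Module.End Fq (Lam n) := mkOp n (fun S => fAct n i S.1)

/-- The operator `e_i` on `Λ`. -/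
def eop (n : ℕ) (i : ℤ) : Module.End Fq (Lam n) := mkOp n (fun S => eAct n i S.1)

/-- The operator `k_i` on `Λ`, `k_i · v_S = q^{(α_i, wt S)} v_S`. -/
def kop (n : ℕ) (i : ℤ) : Module.End Fq (Lam n) :=
  mkOp n (fun S => (qv ^ alphaPair n i S.1) • bv n S)

/-- The operator `k_i⁻¹` on `Λ`. -/
def kinvop (n : ℕ) (i : ℤ) : Module.End Fq (Lam n) :=
  mkOp n (fun S => (qv ^ (-alphaPair n i S.1)) • bv n S)

/-- `−S`. -/
def negSet (S : Finset ℤ) : Finset ℤ := S.image (fun x => -x)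

/-- `S₀ = S ∩ (−S)`, the fully dotted columns. -/
def Szero (S : Finset ℤ) : Finset ℤ := S ∩ negSet S

/-- `S₀^c = (I∖S) ∩ (−(I∖S))`, the undotted columns. -/
def Szeroc (n : ℕ) (S : Finset ℤ) : Finset ℤ := (Iset n \ S) ∩ negSet (Iset n \ S)

/-- `w(S) = (|S₀| − |S₀^c|)/2`. -/
def wTot (n : ℕ) (S : Finset ℤ) : ℤ :=
  (((Szero S).card : ℤ) - ((Szeroc n S).card : ℤ)) / 2

/-- `w_{>i}(S)`. -/
def wGt (n : ℕ) (i : ℤ) (S : Finset ℤ) : ℤ :=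
  ((((Szero S).filter (fun x => i < |x| ∧ |x| ≤ (n : ℤ))).card : ℤ)
    - (((Szeroc n S).filter (fun x => i < |x| ∧ |x| ≤ (n : ℤ))).card : ℤ)) / 2

/-- `w_{<i}(S)`. -/
def wLt (n : ℕ) (i : ℤ) (S : Finset ℤ) : ℤ :=
  ((((Szeroc n S).filter (fun x => x ≠ 0 ∧ |x| < i)).card : ℤ)
    - (((Szero S).filter (fun x => x ≠ 0 ∧ |x| < i)).card : ℤ)) / 2

/-- Value of `E` on `v_S`. -/
def EAct (n : ℕ) (S : Finset ℤ) : Lam n :=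
  ∑ i ∈ (Finset.Icc (1 : ℤ) (n : ℤ)).filter (fun i => i ∈ Szeroc n S ∧ -i ∈ Szeroc n S),
    ((-qv) ^ wGt n i S) • vS n (insert i (insert (-i) S))

/-- Value of `F` on `v_S`. -/
def FAct (n : ℕ) (S : Finset ℤ) : Lam n :=
  ∑ i ∈ (Finset.Icc (1 : ℤ) (n : ℤ)).filter (fun i => i ∈ Szero S ∧ -i ∈ Szero S),
    ((-qv) ^ wLt n i S) • vS n ((S.erase i).erase (-i))

/-- The operator `E` on `Λ`. -/
def Eop (n : ℕ) : Module.End Fq (Lam n) := mkOp n (fun S => EAct n S.1)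

/-- The operator `F` on `Λ`. -/
def Fop (n : ℕ) : Module.End Fq (Lam n) := mkOp n (fun S => FAct n S.1)

/-- The operator `K` on `Λ`, `K · v_S = (−q)^{w(S)} v_S`. -/
def Kop (n : ℕ) : Module.End Fq (Lam n) := mkOp n (fun S => ((-qv) ^ wTot n S.1) • bv n S)

/-- The operator `K⁻¹` on `Λ`. -/
def Kinvop (n : ℕ) : Module.End Fq (Lam n) :=
  mkOp n (fun S => ((-qv) ^ (-wTot n S.1)) • bv n S)

/-- Balanced quantum integer `[m]_x`. -/
def qNum (x : Fq) (m : ℕ) : Fq := (x ^ (m : ℤ) - x ^ (-(m : ℤ))) / (x - x⁻¹)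

/-- Quantum factorial `[m]_x!`. -/
def qFact (x : Fq) (m : ℕ) : Fq := ∏ j ∈ Finset.range m, qNum x (j + 1)

/-- Gaussian binomial coefficient in the variable `x`. -/
def qBinom (x : Fq) (m s : ℕ) : Fq := qFact x m / (qFact x s * qFact x (m - s))

/-- The variable `q_i`: `q` for `i < n` and `q²` for `i = n`. -/
def qsub (n : ℕ) (i : ℤ) : Fq := if i = (n : ℤ) then qv ^ 2 else qv

/-- The subring `A = ℤ[q,q⁻¹] ⊆ 𝔽`. -/
def Asub : Subring Fq := Subring.closure {qv, qv⁻¹}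

/-- The `A`-lattice `Λ_A ⊆ Λ`: the `A`-span of all `v_S`. -/
def LamA (n : ℕ) : Set (Lam n) :=
  {x | ∃ c : Bset n →₀ Fq, (∀ S, c S ∈ Asub) ∧ x = c.sum (fun S a => a • bv n S)}

/-- The degree-`k` part `Λ^k ⊆ Λ`. -/
def Lk (n k : ℕ) : Submodule Fq (Lam n) :=
  Submodule.span Fq {x | ∃ S : Bset n, S.1.card = k ∧ x = bv n S}

/-- The divided power `E^{(m)} = E^m/[m]!`. -/
def Ediv (n : ℕ) (m : ℕ) : Module.End Fq (Lam n) := (qFact qv m)⁻¹ • (Eop n ^ m)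

/-- The divided power `F^{(m)} = F^m/[m]!`. -/
def Fdiv (n : ℕ) (m : ℕ) : Module.End Fq (Lam n) := (qFact qv m)⁻¹ • (Fop n ^ m)

/-- The map σ determined by σ(v_S) = v_{−S}. -/
def sigmaOp (n : ℕ) : Module.End Fq (Lam n) := mkOp n (fun S => vS n (negSet S.1))

theorem mem_negSet {S : Finset ℤ} {x : ℤ} : x ∈ negSet S ↔ -x ∈ S := by
  simp [negSet, neg_eq_iff_eq_neg]

theorem negSet_negSet (S : Finset ℤ) : negSet (negSet S) = S := by
  ext x
  simp [mem_negSet]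

theorem card_negSet (S : Finset ℤ) : (negSet S).card = S.card :=
  Finset.card_image_of_injective S neg_injective

theorem negSet_insert (a : ℤ) (S : Finset ℤ) : negSet (insert a S) = insert (-a) (negSet S) :=
  Finset.image_insert _ a S

theorem negSet_singleton (a : ℤ) : negSet {a} = {-a} := rfl

theorem negSet_erase (S : Finset ℤ) (a : ℤ) : negSet (S.erase a) = (negSet S).erase (-a) :=
  Finset.image_erase neg_injective S a

theorem negSet_inter (S T : Finset ℤ) : negSet (S ∩ T) = negSet S ∩ negSet T :=
  Finset.image_inter S T neg_injective

theorem negSet_quad (i : ℤ) : negSet (quad i) = quad i := by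
  ext x
  simp only [quad, mem_negSet, Finset.mem_insert, Finset.mem_singleton]
  lia

/-- `−S` meets the four positions at `i` in `T` exactly when `S` meets them in `−T`. -/
theorem negSet_inter_quad_eq_iff (S T : Finset ℤ) (i : ℤ) :
    negSet S ∩ quad i = T ↔ S ∩ quad i = negSet T := by
  rw [← negSet_quad i, ← negSet_inter, negSet_quad]
  constructor
  · rintro rfl
    rw [negSet_negSet]
  · intro h
    rw [h, negSet_negSet]

theorem negSet_subset_Iset {n : ℕ} {S : Finset ℤ} (h : S ⊆ Iset n) : negSet S ⊆ Iset n := by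
  intro x hx
  have := h (mem_negSet.1 hx)
  simp only [Iset, Finset.mem_erase, Finset.mem_Icc] at this ⊢
  lia

theorem negSet_subset_Iset_iff {n : ℕ} {S : Finset ℤ} : negSet S ⊆ Iset n ↔ S ⊆ Iset n :=
  ⟨fun h => negSet_negSet S ▸ negSet_subset_Iset h, negSet_subset_Iset⟩

theorem mkOp_bv (n : ℕ) (g : Bset n → Lam n) (S : Bset n) : mkOp n g (bv n S) = g S := by
  simp [mkOp, bv]

theorem vS_of_subset {n : ℕ} {T : Finset ℤ} (h : T ⊆ Iset n) : vS n T = bv n ⟨T, h⟩ :=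
  dif_pos h

theorem mkOp_vS {n : ℕ} (g : Bset n → Lam n) {T : Finset ℤ} (h : T ⊆ Iset n) :
    mkOp n g (vS n T) = g ⟨T, h⟩ := by
  rw [vS_of_subset h, mkOp_bv]

/-- Operators on `Λ` are determined by their values on the standard basis. -/
theorem end_ext_bv {n : ℕ} {f g : Module.End Fq (Lam n)} (h : ∀ S, f (bv n S) = g (bv n S)) :
    f = g :=
  Finsupp.lhom_ext' fun S => LinearMap.ext_ring (h S)

theorem sigmaOp_bv (n : ℕ) (S : Bset n) : sigmaOp n (bv n S) = vS n (negSet S.1) :=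
  mkOp_bv n _ S

theorem sigmaOp_vS (n : ℕ) (T : Finset ℤ) : sigmaOp n (vS n T) = vS n (negSet T) := by
  by_cases h : T ⊆ Iset n
  · exact mkOp_vS _ h
  · simp [vS, h, negSet_subset_Iset_iff]

theorem sigmaOp_mul_self (n : ℕ) : sigmaOp n * sigmaOp n = 1 := by
  refine end_ext_bv fun S => ?_
  rw [Module.End.mul_apply, sigmaOp_bv, sigmaOp_vS, negSet_negSet, vS_of_subset S.2]
  rfl

theorem sigmaOp_involutive (n : ℕ) : Function.Involutive (sigmaOp n) :=
  LinearMap.congr_fun (sigmaOp_mul_self n)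

theorem sigmaOp_mem_Lk {n k : ℕ} {x : Lam n} (hx : x ∈ Lk n k) : sigmaOp n x ∈ Lk n k := by
  suffices h : Lk n k ≤ (Lk n k).comap (sigmaOp n) from h hx
  refine Submodule.span_le.2 ?_
  rintro _ ⟨S, hS, rfl⟩
  refine Submodule.subset_span ⟨⟨negSet S.1, negSet_subset_Iset S.2⟩, ?_, ?_⟩
  · exact (card_negSet S.1).trans hS
  · rw [sigmaOp_bv, vS_of_subset]

theorem sigmaOp_eAct (n : ℕ) (i : ℤ) (S : Finset ℤ) :
    sigmaOp n (eAct n i S) = fAct n i (negSet S) := by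
  have reverse (a b c : ℤ) : ({a, b, c} : Finset ℤ) = {c, b, a} := by
    rw [Finset.insert_comm, Finset.pair_comm a c, Finset.insert_comm]
  unfold eAct fAct
  simp only [negSet_inter_quad_eq_iff, negSet_insert, negSet_singleton, mem_negSet, neg_neg]
  rw [reverse (-i) (i + 1) i, reverse (-i) (-(i + 1)) (i + 1), Finset.pair_comm (-i) (i + 1),
    Finset.pair_comm (-i) i, Finset.pair_comm (-(i + 1)) (i + 1)]
  simp only [apply_ite (sigmaOp n), map_add, map_smul, map_zero, sigmaOp_vS, negSet_insert,
    negSet_erase, neg_neg]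

theorem sigmaOp_mul_eop (n : ℕ) (i : ℤ) : sigmaOp n * eop n i = fop n i * sigmaOp n := by
  refine end_ext_bv fun S => ?_
  rw [Module.End.mul_apply, Module.End.mul_apply, sigmaOp_bv, eop, fop, mkOp_bv,
    mkOp_vS _ (negSet_subset_Iset S.2), sigmaOp_eAct]

theorem sigmaOp_mul_fop (n : ℕ) (i : ℤ) : sigmaOp n * fop n i = eop n i * sigmaOp n := by
  calc sigmaOp n * fop n i = sigmaOp n * (fop n i * sigmaOp n) * sigmaOp n := by
        rw [mul_assoc, mul_assoc, sigmaOp_mul_self, mul_one]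
    _ = eop n i * sigmaOp n := by
        rw [← sigmaOp_mul_eop, ← mul_assoc, sigmaOp_mul_self, one_mul]

theorem epsCoef_negSet (S : Finset ℤ) (j : ℤ) : epsCoef (negSet S) j = -epsCoef S j := by
  simp [epsCoef, mem_negSet]

theorem alphaPair_negSet (n : ℕ) (i : ℤ) (S : Finset ℤ) :
    alphaPair n i (negSet S) = -alphaPair n i S := by
  unfold alphaPair
  split_ifs <;> simp only [epsCoef_negSet] <;> ring

theorem sigmaOp_mul_kop (n : ℕ) (i : ℤ) : sigmaOp n * kop n i = kinvop n i * sigmaOp n := by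
  refine end_ext_bv fun S => ?_
  rw [Module.End.mul_apply, Module.End.mul_apply, kop, kinvop, mkOp_bv, map_smul, sigmaOp_bv,
    mkOp_vS _ (negSet_subset_Iset S.2), alphaPair_negSet, neg_neg,
    vS_of_subset (negSet_subset_Iset S.2)]

/-- σ is bijective, preserves each Λ^k, and satisfies σ∘e_i = f_i∘σ,
σ∘f_i = e_i∘σ and σ∘k_i = k_i⁻¹∘σ for all i ∈ {1,…,n}. -/
theorem stmt2 (n : ℕ) (hn : 1 ≤ n) :
    Function.Bijective (sigmaOp n) ∧
    (∀ k : ℕ, ∀ x ∈ Lk n k, sigmaOp n x ∈ Lk n k) ∧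
    ∀ i ∈ Finset.Icc (1 : ℤ) (n : ℤ),
      (sigmaOp n * eop n i = fop n i * sigmaOp n) ∧
      (sigmaOp n * fop n i = eop n i * sigmaOp n) ∧
      (sigmaOp n * kop n i = kinvop n i * sigmaOp n) := by
  exact ⟨(sigmaOp_involutive n).bijective, fun _ _ => sigmaOp_mem_Lk, fun i _ =>
    ⟨sigmaOp_mul_eop n i, sigmaOp_mul_fop n i, sigmaOp_mul_kop n i⟩⟩

end
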